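/- Let X = λ₁T + λ₂N + λ₃B be a non-isotropic vector field along α (λ₁ nowhere zero) with λ₁, λ₂, λ₃ : ℝ → ℝ smooth. Then X is Fermi–Walker transported along α (∇̃_T X = 0 identically) if and only if λ₁ is constant and there exist constants c₁, c₂ such that λ₂(x) = c₁ cos(∫₁ˣ τ(t) dt) + c₂ sin(∫₁ˣ τ(t) dt) and λ₃(x) = c₂ cos(∫₁ˣ τ(t) dt) − c₁ sin(∫₁ˣ τ(t) dt) for all x. -/

import Mathlib

/-- The Galilean scalar product on `ℝ³`: `v₁w₁` if `v₁ ≠ 0` or `w₁ ≠ 0`,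
and `v₂w₂ + v₃w₃` if `v₁ = 0` and `w₁ = 0`. -/
noncomputable def gProd (v w : Fin 3 → ℝ) : ℝ :=
  if v 0 ≠ 0 ∨ w 0 ≠ 0 then v 0 * w 0 else v 1 * w 1 + v 2 * w 2

/-- The admissible curve `α(x) = (x, y(x), z(x))` in Galilean 3-space. -/
noncomputable def curve (y z : ℝ → ℝ) : ℝ → Fin 3 → ℝ :=
  fun x => ![x, y x, z x]

/-- The Fermi–Walker derivative along `α = curve y z`:
`∇̃_T X = X' − ⟨T,X⟩A + ⟨A,X⟩T`, where `T = α'` and `A = T' = α''`. -/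
noncomputable def FW (y z : ℝ → ℝ) (X : ℝ → Fin 3 → ℝ) (x : ℝ) : Fin 3 → ℝ :=
  deriv X x
    - gProd (deriv (curve y z) x) (X x) • deriv (deriv (curve y z)) x
    + gProd (deriv (deriv (curve y z)) x) (X x) • deriv (curve y z) x

/-- The tangent `T = α' = (1, y', z')`. -/
noncomputable def Tvec (y z : ℝ → ℝ) (x : ℝ) : Fin 3 → ℝ :=
  ![1, deriv y x, deriv z x]

/-- The curvature `κ = √(y''² + z''²)`. -/
noncomputable def kappa (y z : ℝ → ℝ) (x : ℝ) : ℝ :=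
  Real.sqrt (deriv (deriv y) x ^ 2 + deriv (deriv z) x ^ 2)

/-- The principal normal `N = (1/κ)(0, y'', z'')`. -/
noncomputable def Nvec (y z : ℝ → ℝ) (x : ℝ) : Fin 3 → ℝ :=
  (kappa y z x)⁻¹ • ![0, deriv (deriv y) x, deriv (deriv z) x]

/-- The binormal `B = (1/κ)(0, −z'', y'')`. -/
noncomputable def Bvec (y z : ℝ → ℝ) (x : ℝ) : Fin 3 → ℝ :=
  (kappa y z x)⁻¹ • ![0, -deriv (deriv z) x, deriv (deriv y) x]

/-- The torsion `τ = det(α', α'', α''') / κ²`. -/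
noncomputable def tors (y z : ℝ → ℝ) (x : ℝ) : ℝ :=
  (Matrix.of ![![(1 : ℝ), deriv y x, deriv z x],
    ![0, deriv (deriv y) x, deriv (deriv z) x],
    ![0, deriv (deriv (deriv y)) x, deriv (deriv (deriv z)) x]]).det / kappa y z x ^ 2

/-- Solutions of the rotation system `f' = τ g`, `g' = -τ f` with continuous coefficient `τ`. -/
theorem hasDerivAt_rotation_iff {τ f g : ℝ → ℝ} (hτ : Continuous τ) (a : ℝ) :
    (∀ x, HasDerivAt f (τ x * g x) x ∧ HasDerivAt g (-(τ x * f x)) x) ↔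
      ∃ c₁ c₂ : ℝ, ∀ x,
        f x = c₁ * Real.cos (∫ t in a..x, τ t) + c₂ * Real.sin (∫ t in a..x, τ t) ∧
        g x = c₂ * Real.cos (∫ t in a..x, τ t) - c₁ * Real.sin (∫ t in a..x, τ t) := by
  have hθ : ∀ x, HasDerivAt (fun x => ∫ t in a..x, τ t) (τ x) x := fun x =>
    hτ.integral_hasStrictDerivAt a x |>.hasDerivAt
  set θ : ℝ → ℝ := fun x => ∫ t in a..x, τ t
  constructor
  · intro h
    have hF : ∀ x, HasDerivAt (fun x => f x * Real.cos (θ x) - g x * Real.sin (θ x)) 0 x := by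
      intro x
      refine HasDerivAt.congr_deriv (((h x).1.mul (hθ x).cos).sub ((h x).2.mul (hθ x).sin)) ?_
      ring
    have hG : ∀ x, HasDerivAt (fun x => f x * Real.sin (θ x) + g x * Real.cos (θ x)) 0 x := by
      intro x
      refine HasDerivAt.congr_deriv (((h x).1.mul (hθ x).sin).add ((h x).2.mul (hθ x).cos)) ?_
      ring
    refine ⟨f a * Real.cos (θ a) - g a * Real.sin (θ a),
      f a * Real.sin (θ a) + g a * Real.cos (θ a), fun x => ?_⟩
    have eF := is_const_of_deriv_eq_zero (fun x => (hF x).differentiableAt)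
      (fun x => (hF x).deriv) a x
    have eG := is_const_of_deriv_eq_zero (fun x => (hG x).differentiableAt)
      (fun x => (hG x).deriv) a x
    rw [eF, eG]
    have := Real.sin_sq_add_cos_sq (θ x)
    constructor
    · linear_combination -f x * this
    · linear_combination -g x * this
  · rintro ⟨c₁, c₂, h⟩ x
    have hf : f = fun x => c₁ * Real.cos (θ x) + c₂ * Real.sin (θ x) := funext fun x => (h x).1
    have hg : g = fun x => c₂ * Real.cos (θ x) - c₁ * Real.sin (θ x) := funext fun x => (h x).2
    constructor
    · rw [hf, hg]
      refine HasDerivAt.congr_deriv (((hθ x).cos.const_mul c₁).add ((hθ x).sin.const_mul c₂)) ?_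
      ring
    · rw [hf, hg]
      refine HasDerivAt.congr_deriv (((hθ x).cos.const_mul c₂).sub ((hθ x).sin.const_mul c₁)) ?_
      ring

theorem ContDiff.deriv_smooth {f : ℝ → ℝ} (hf : ContDiff ℝ (⊤ : ℕ∞) f) :
    ContDiff ℝ (⊤ : ℕ∞) (deriv f) :=
  (contDiff_infty_iff_deriv.1 hf).2

theorem ContDiff.hasDerivAt_of_smooth {f : ℝ → ℝ} (hf : ContDiff ℝ (⊤ : ℕ∞) f) (x : ℝ) :
    HasDerivAt f (deriv f x) x :=
  ((contDiff_infty_iff_deriv.1 hf).1 x).hasDerivAt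

section GalileanFrame

theorem kappa_sq (y z : ℝ → ℝ) (x : ℝ) :
    kappa y z x ^ 2 = deriv (deriv y) x ^ 2 + deriv (deriv z) x ^ 2 :=
  Real.sq_sqrt (by positivity)

theorem tors_eq (y z : ℝ → ℝ) (x : ℝ) :
    tors y z x = (deriv (deriv y) x * deriv (deriv (deriv z)) x
      - deriv (deriv z) x * deriv (deriv (deriv y)) x) / kappa y z x ^ 2 := by
  simp [tors, Matrix.det_fin_three]

variable {y z : ℝ → ℝ}

theorem continuous_tors (hy : ContDiff ℝ (⊤ : ℕ∞) y) (hz : ContDiff ℝ (⊤ : ℕ∞) z)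
    (hκ : ∀ x, 0 < kappa y z x) : Continuous (tors y z) := by
  have hy₂ := hy.deriv_smooth.deriv_smooth
  have hz₂ := hz.deriv_smooth.deriv_smooth
  have c₁ := hy₂.continuous
  have c₂ := hz₂.continuous
  have c₃ := hy₂.deriv_smooth.continuous
  have c₄ := hz₂.deriv_smooth.continuous
  have key : tors y z = fun x => (deriv (deriv y) x * deriv (deriv (deriv z)) x
      - deriv (deriv z) x * deriv (deriv (deriv y)) x)
      / (deriv (deriv y) x ^ 2 + deriv (deriv z) x ^ 2) := by
    funext x
    rw [tors_eq, kappa_sq]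
  rw [key]
  refine Continuous.div (by fun_prop) (by fun_prop) fun x => ?_
  rw [← kappa_sq]
  exact (pow_pos (hκ x) 2).ne'

theorem hasDerivAt_kappa (hy : ContDiff ℝ (⊤ : ℕ∞) y) (hz : ContDiff ℝ (⊤ : ℕ∞) z)
    {x : ℝ} (hκ : 0 < kappa y z x) :
    HasDerivAt (kappa y z) ((deriv (deriv y) x * deriv (deriv (deriv y)) x
      + deriv (deriv z) x * deriv (deriv (deriv z)) x) / kappa y z x) x := by
  have hp := hy.deriv_smooth.deriv_smooth.hasDerivAt_of_smooth x
  have hq := hz.deriv_smooth.deriv_smooth.hasDerivAt_of_smooth x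
  have hne : deriv (deriv y) x ^ 2 + deriv (deriv z) x ^ 2 ≠ 0 := by
    rw [← kappa_sq]
    exact (pow_pos hκ 2).ne'
  have h := ((hp.pow 2).add (hq.pow 2)).sqrt hne
  refine h.congr_deriv ?_
  change _ / (2 * kappa y z x) = _
  field_simp
  ring

/-- Frenet equation `N' = τ B`, first isotropic coordinate. -/
theorem hasDerivAt_normal_fst (hy : ContDiff ℝ (⊤ : ℕ∞) y) (hz : ContDiff ℝ (⊤ : ℕ∞) z)
    {x : ℝ} (hκ : 0 < kappa y z x) :
    HasDerivAt (fun x => (kappa y z x)⁻¹ * deriv (deriv y) x)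
      (-(tors y z x * ((kappa y z x)⁻¹ * deriv (deriv z) x))) x := by
  have hp := hy.deriv_smooth.deriv_smooth.hasDerivAt_of_smooth x
  refine (((hasDerivAt_kappa hy hz hκ).inv hκ.ne').mul hp).congr_deriv ?_
  have hk := kappa_sq y z x
  rw [tors_eq, Pi.inv_apply]
  field_simp
  linear_combination deriv (deriv (deriv y)) x * hk

/-- Frenet equation `N' = τ B`, second isotropic coordinate. -/
theorem hasDerivAt_normal_snd (hy : ContDiff ℝ (⊤ : ℕ∞) y) (hz : ContDiff ℝ (⊤ : ℕ∞) z)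
    {x : ℝ} (hκ : 0 < kappa y z x) :
    HasDerivAt (fun x => (kappa y z x)⁻¹ * deriv (deriv z) x)
      (tors y z x * ((kappa y z x)⁻¹ * deriv (deriv y) x)) x := by
  have hq := hz.deriv_smooth.deriv_smooth.hasDerivAt_of_smooth x
  refine (((hasDerivAt_kappa hy hz hκ).inv hκ.ne').mul hq).congr_deriv ?_
  have hk := kappa_sq y z x
  rw [tors_eq, Pi.inv_apply]
  field_simp
  linear_combination deriv (deriv (deriv z)) x * hk

theorem deriv_curve (hy : ContDiff ℝ (⊤ : ℕ∞) y) (hz : ContDiff ℝ (⊤ : ℕ∞) z) :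
    deriv (curve y z) = Tvec y z := by
  funext x
  refine (hasDerivAt_pi.2 fun i => ?_).deriv
  fin_cases i
  · exact hasDerivAt_id x
  · exact hy.hasDerivAt_of_smooth x
  · exact hz.hasDerivAt_of_smooth x

theorem deriv_Tvec (hy : ContDiff ℝ (⊤ : ℕ∞) y) (hz : ContDiff ℝ (⊤ : ℕ∞) z) (x : ℝ) :
    deriv (Tvec y z) x = ![0, deriv (deriv y) x, deriv (deriv z) x] := by
  refine (hasDerivAt_pi.2 fun i => ?_).deriv
  fin_cases i
  · exact hasDerivAt_const x 1
  · exact hy.deriv_smooth.hasDerivAt_of_smooth x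
  · exact hz.deriv_smooth.hasDerivAt_of_smooth x

/-- The Fermi–Walker derivative of a non-isotropic field in the Frenet frame. -/
theorem FW_frenet (hy : ContDiff ℝ (⊤ : ℕ∞) y) (hz : ContDiff ℝ (⊤ : ℕ∞) z)
    {lam₁ lam₂ lam₃ : ℝ → ℝ} {X : ℝ → Fin 3 → ℝ}
    (hX : ∀ x, X x = lam₁ x • Tvec y z x + lam₂ x • Nvec y z x + lam₃ x • Bvec y z x)
    {x a b c : ℝ} (hκ : 0 < kappa y z x) (h₁ : HasDerivAt lam₁ a x)
    (h₂ : HasDerivAt lam₂ b x) (h₃ : HasDerivAt lam₃ c x) (hne : lam₁ x ≠ 0) :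
    FW y z X x = a • Tvec y z x + (b - tors y z x * lam₃ x) • Nvec y z x
      + (c + tors y z x * lam₂ x) • Bvec y z x := by
  set u : ℝ → ℝ := fun x => (kappa y z x)⁻¹ * deriv (deriv y) x with hu
  set v : ℝ → ℝ := fun x => (kappa y z x)⁻¹ * deriv (deriv z) x with hv
  have hdu : HasDerivAt u (-(tors y z x * v x)) x := hasDerivAt_normal_fst hy hz hκ
  have hdv : HasDerivAt v (tors y z x * u x) x := hasDerivAt_normal_snd hy hz hκ
  have hX' : X = fun x => ![lam₁ x, lam₁ x * deriv y x + lam₂ x * u x - lam₃ x * v x,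
      lam₁ x * deriv z x + lam₂ x * v x + lam₃ x * u x] := by
    funext x i
    rw [hX]
    fin_cases i <;> simp [Tvec, Nvec, Bvec, hu, hv, sub_eq_add_neg]
  have hdX : HasDerivAt X ![a,
      (a * deriv y x + lam₁ x * deriv (deriv y) x)
        + (b * u x + lam₂ x * -(tors y z x * v x)) - (c * v x + lam₃ x * (tors y z x * u x)),
      (a * deriv z x + lam₁ x * deriv (deriv z) x)
        + (b * v x + lam₂ x * (tors y z x * u x))
        + (c * u x + lam₃ x * -(tors y z x * v x))] x := by
    rw [hX']
    refine hasDerivAt_pi.2 fun i => ?_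
    fin_cases i
    · exact h₁
    · exact ((h₁.mul (hy.deriv_smooth.hasDerivAt_of_smooth x)).add (h₂.mul hdu)).sub
        (h₃.mul hdv)
    · exact ((h₁.mul (hz.deriv_smooth.hasDerivAt_of_smooth x)).add (h₂.mul hdv)).add
        (h₃.mul hdu)
  have hX₀ : X x 0 = lam₁ x := by simp [hX']
  rw [FW, hdX.deriv, deriv_curve hy hz, deriv_Tvec hy hz]
  simp only [gProd, hX₀, hne, ne_eq, not_false_eq_true, or_true, if_true]
  funext i
  fin_cases i <;> simp [Tvec, Nvec, Bvec, hu, hv] <;> ring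

/-- The Frenet frame is linearly independent. -/
theorem frenet_combination_eq_zero_iff {x a b c : ℝ} (hκ : 0 < kappa y z x) :
    a • Tvec y z x + b • Nvec y z x + c • Bvec y z x = 0 ↔ a = 0 ∧ b = 0 ∧ c = 0 := by
  refine ⟨fun h => ?_, by rintro ⟨rfl, rfl, rfl⟩; simp⟩
  have ha : a = 0 := by simpa [Tvec, Nvec, Bvec] using congrFun h 0
  have e₁ := congrFun h 1
  have e₂ := congrFun h 2
  simp only [Tvec, Nvec, Bvec, ha, Pi.add_apply, Pi.smul_apply, Pi.zero_apply, smul_eq_mul,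
    Matrix.cons_val] at e₁ e₂
  field_simp at e₁ e₂
  have hk := kappa_sq y z x
  have hk₀ : kappa y z x ^ 2 ≠ 0 := (pow_pos hκ 2).ne'
  refine ⟨ha, (mul_eq_zero.1 ?_).resolve_right hk₀, (mul_eq_zero.1 ?_).resolve_right hk₀⟩
  · linear_combination b * hk + deriv (deriv y) x * e₁ + deriv (deriv z) x * e₂
  · linear_combination c * hk - deriv (deriv z) x * e₁ + deriv (deriv y) x * e₂

end GalileanFrame

/-- A non-isotropic field `X = λ₁T + λ₂N + λ₃B` (with `λ₁` nowhere zero)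
is Fermi–Walker transported iff `λ₁` is constant and `λ₂, λ₃` are the stated
cosine/sine combinations of `∫₁ˣ τ`. -/
theorem fermiWalker_transported_nonisotropic_iff
    (y z : ℝ → ℝ) (hy : ContDiff ℝ (⊤ : ℕ∞) y) (hz : ContDiff ℝ (⊤ : ℕ∞) z)
    (hκ : ∀ x, 0 < kappa y z x)
    (lam₁ lam₂ lam₃ : ℝ → ℝ)
    (h₁ : ContDiff ℝ (⊤ : ℕ∞) lam₁) (h₂ : ContDiff ℝ (⊤ : ℕ∞) lam₂) (h₃ : ContDiff ℝ (⊤ : ℕ∞) lam₃)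
    (hlam₁ : ∀ x, lam₁ x ≠ 0)
    (X : ℝ → Fin 3 → ℝ)
    (hX : ∀ x, X x = lam₁ x • Tvec y z x + lam₂ x • Nvec y z x + lam₃ x • Bvec y z x) :
    (∀ x : ℝ, FW y z X x = 0) ↔
      ((∃ c : ℝ, ∀ x, lam₁ x = c) ∧ ∃ c₁ c₂ : ℝ, ∀ x : ℝ,
        lam₂ x = c₁ * Real.cos (∫ t in (1:ℝ)..x, tors y z t)
               + c₂ * Real.sin (∫ t in (1:ℝ)..x, tors y z t) ∧
        lam₃ x = c₂ * Real.cos (∫ t in (1:ℝ)..x, tors y z t)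
               - c₁ * Real.sin (∫ t in (1:ℝ)..x, tors y z t)) := by
  rw [← hasDerivAt_rotation_iff (continuous_tors hy hz hκ) 1]
  have hFW : ∀ x, FW y z X x = 0 ↔ deriv lam₁ x = 0 ∧
      deriv lam₂ x - tors y z x * lam₃ x = 0 ∧ deriv lam₃ x + tors y z x * lam₂ x = 0 := by
    intro x
    rw [FW_frenet hy hz hX (hκ x) (h₁.hasDerivAt_of_smooth x) (h₂.hasDerivAt_of_smooth x)
      (h₃.hasDerivAt_of_smooth x) (hlam₁ x), frenet_combination_eq_zero_iff (hκ x)]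
  simp only [hFW]
  constructor
  · intro h
    refine ⟨⟨lam₁ 1, fun x => is_const_of_deriv_eq_zero
      (fun x => (h₁.hasDerivAt_of_smooth x).differentiableAt) (fun x => (h x).1) x 1⟩,
      fun x => ⟨?_, ?_⟩⟩
    · exact (h₂.hasDerivAt_of_smooth x).congr_deriv (sub_eq_zero.1 (h x).2.1)
    · exact (h₃.hasDerivAt_of_smooth x).congr_deriv (eq_neg_of_add_eq_zero_left (h x).2.2)
  · rintro ⟨⟨c, hc⟩, h⟩ x
    refine ⟨?_, ?_, ?_⟩
    · rw [funext hc, deriv_const]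
    · rw [(h x).1.deriv, sub_self]
    · rw [(h x).2.deriv, neg_add_cancel]
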